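/- There is a constant K > 0 such that for every positive integer m there exists a finite simple graph G_m with at most K·m² vertices which admits an unaligned 2-bend EPG representation, and yet in every unaligned 2-bend EPG representation of G_m the segments occurring in the representation realize at least m/2 pairwise non-parallel directions. Consequently, representing all unaligned 2-bend graphs on n vertices requires Ω(√n) slopes. -/

import Mathlib

open Set

/-- An unaligned 2-bend path: a union of at most three closed segments of positive
length, consecutive ones sharing an endpoint and not collinear (arbitrary slopes). -/
def IsUn2BendPath (P : Set (ℝ × ℝ)) : Prop :=
  (∃ p q : ℝ × ℝ, p ≠ q ∧ P = segment ℝ p q) ∨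
  (∃ p q r : ℝ × ℝ, p ≠ q ∧ q ≠ r ∧ ¬ Collinear ℝ ({p, q, r} : Set (ℝ × ℝ)) ∧
    P = segment ℝ p q ∪ segment ℝ q r) ∨
  (∃ p q r s : ℝ × ℝ, p ≠ q ∧ q ≠ r ∧ r ≠ s ∧
    ¬ Collinear ℝ ({p, q, r} : Set (ℝ × ℝ)) ∧ ¬ Collinear ℝ ({q, r, s} : Set (ℝ × ℝ)) ∧
    P = segment ℝ p q ∪ segment ℝ q r ∪ segment ℝ r s)

/-- An unaligned 2-bend EPG representation of a graph. -/
def IsUn2BendEPG {V : Type*} (G : SimpleGraph V) (f : V → Set (ℝ × ℝ)) : Prop :=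
  (∀ v, IsUn2BendPath (f v)) ∧
  ∀ u v : V, u ≠ v → (G.Adj u v ↔ (f u ∩ f v).Infinite)

/-- The direction (slope) of the segment from `p` to `q`: the line through the origin
parallel to it. -/
def segDir (p q : ℝ × ℝ) : Submodule ℝ (ℝ × ℝ) := Submodule.span ℝ {q - p}

/-- `P` is an unaligned 2-bend path all of whose segments have directions in `D`. -/
def Un2BendWithDirs (P : Set (ℝ × ℝ)) (D : Set (Submodule ℝ (ℝ × ℝ))) : Prop :=
  (∃ p q : ℝ × ℝ, p ≠ q ∧ segDir p q ∈ D ∧ P = segment ℝ p q) ∨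
  (∃ p q r : ℝ × ℝ, p ≠ q ∧ q ≠ r ∧ ¬ Collinear ℝ ({p, q, r} : Set (ℝ × ℝ)) ∧
    segDir p q ∈ D ∧ segDir q r ∈ D ∧
    P = segment ℝ p q ∪ segment ℝ q r) ∨
  (∃ p q r s : ℝ × ℝ, p ≠ q ∧ q ≠ r ∧ r ≠ s ∧
    ¬ Collinear ℝ ({p, q, r} : Set (ℝ × ℝ)) ∧ ¬ Collinear ℝ ({q, r, s} : Set (ℝ × ℝ)) ∧
    segDir p q ∈ D ∧ segDir q r ∈ D ∧ segDir r s ∈ D ∧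
    P = segment ℝ p q ∪ segment ℝ q r ∪ segment ℝ r s)



namespace Slopes

open AffineMap

/-- `P` contains a short initial piece of the ray from `x` in direction `v`. -/
def HasGerm (P : Set (ℝ × ℝ)) (x v : ℝ × ℝ) : Prop :=
  ∃ ε : ℝ, 0 < ε ∧ ∀ t : ℝ, 0 ≤ t → t ≤ ε → x + t • v ∈ P

/-- Lexicographic positivity, used to orient lines. -/
def Pos (v : ℝ × ℝ) : Prop := 0 < v.1 ∨ (v.1 = 0 ∧ 0 < v.2)

lemma HasGerm.mono {P Q : Set (ℝ × ℝ)} {x v : ℝ × ℝ} (h : HasGerm P x v) (hPQ : P ⊆ Q) :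
    HasGerm Q x v := by
  obtain ⟨ε, h0, h⟩ := h
  exact ⟨ε, h0, fun t h1 h2 => hPQ (h t h1 h2)⟩

lemma HasGerm.scale {P : Set (ℝ × ℝ)} {x v : ℝ × ℝ} (h : HasGerm P x v) {c : ℝ} (hc : 0 < c) :
    HasGerm P x (c • v) := by
  obtain ⟨ε, h0, h⟩ := h
  refine ⟨ε / c, by positivity, fun t h1 h2 => ?_⟩
  rw [smul_smul]
  apply h
  · positivity
  · rwa [le_div_iff₀ hc] at h2

lemma HasGerm.inter_infinite {P Q : Set (ℝ × ℝ)} {x v : ℝ × ℝ} (hP : HasGerm P x v)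
    (hQ : HasGerm Q x v) (hv : v ≠ 0) : (P ∩ Q).Infinite := by
  obtain ⟨ε, h0, h⟩ := hP
  obtain ⟨ε', h0', h'⟩ := hQ
  have hm : 0 < min ε ε' := lt_min h0 h0'
  have : ((fun t : ℝ => x + t • v) '' Icc 0 (min ε ε')).Infinite := by
    apply Set.Infinite.image _ (Icc_infinite hm)
    intro a _ b _ hab
    simp only [add_right_inj] at hab
    exact smul_left_injective ℝ hv hab
  refine this.mono ?_
  rintro _ ⟨t, ⟨h1, h2⟩, rfl⟩
  exact ⟨h t h1 (h2.trans (min_le_left _ _)), h' t h1 (h2.trans (min_le_right _ _))⟩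

lemma germ_left (p q : ℝ × ℝ) : HasGerm (segment ℝ p q) p (q - p) := by
  refine ⟨1, one_pos, fun t h0 h1 => ?_⟩
  rw [segment_eq_image']
  exact ⟨t, ⟨h0, h1⟩, rfl⟩

lemma germ_right (p q : ℝ × ℝ) : HasGerm (segment ℝ p q) q (p - q) := by
  rw [segment_symm]; exact germ_left q p

lemma pos_smul {v : ℝ × ℝ} {c : ℝ} (hc : 0 < c) : Pos (c • v) ↔ Pos v := by
  simp [Pos, hc, hc.ne']

lemma pos_neg {v : ℝ × ℝ} (hv : v ≠ 0) : Pos (-v) ↔ ¬ Pos v := by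
  simp only [Pos, Prod.fst_neg, Prod.snd_neg]
  have : v.1 ≠ 0 ∨ v.2 ≠ 0 := by
    by_contra! h; exact hv (Prod.ext h.1 h.2)
  rcases lt_trichotomy v.1 0 with h1 | h1 | h1 <;> rcases lt_trichotomy v.2 0 with h2 | h2 | h2 <;>
    simp_all <;> grind

lemma pos_parallel {w v v' : ℝ × ℝ} (hv : v ∈ Submodule.span ℝ {w})
    (hv' : v' ∈ Submodule.span ℝ {w}) (h0 : v ≠ 0) (h0' : v' ≠ 0) (h : Pos v ↔ Pos v') :
    ∃ c : ℝ, 0 < c ∧ v' = c • v := by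
  obtain ⟨a, rfl⟩ := Submodule.mem_span_singleton.1 hv
  obtain ⟨b, rfl⟩ := Submodule.mem_span_singleton.1 hv'
  have ha : a ≠ 0 := by rintro rfl; simp at h0
  have hb : b ≠ 0 := by rintro rfl; simp at h0'
  have e : b • w = (b / a) • (a • w) := by rw [smul_smul]; congr 1; field_simp
  refine ⟨b / a, ?_, e⟩
  by_contra hc
  have hc' : 0 < - (b / a) := by
    have : b / a ≠ 0 := by positivity
    have := lt_of_le_of_ne (not_lt.1 hc) this
    linarith
  have h2 : Pos (b • w) ↔ ¬ Pos (a • w) := by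
    rw [e, ← pos_neg h0, ← pos_smul hc' (v := -(a • w))]
    simp
  tauto

lemma exists_two_of_infinite {S : Set (ℝ × ℝ)} (h : S.Infinite) : ∃ x ∈ S, ∃ y ∈ S, x ≠ y := by
  obtain ⟨x, hx, y, hy, hxy⟩ := h.nontrivial
  exact ⟨x, hx, y, hy, hxy⟩

lemma seg_sub_line (p q : ℝ × ℝ) {x : ℝ × ℝ} (h : x ∈ segment ℝ p q) : x ∈ line[ℝ, p, q] := by
  rw [segment_eq_image_lineMap] at h
  obtain ⟨t, _, rfl⟩ := h
  exact lineMap_mem_affineSpan_pair _ _ _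

lemma line_eq_of_overlap {a b c d : ℝ × ℝ}
    (h : (segment ℝ a b ∩ segment ℝ c d).Infinite) : line[ℝ, a, b] = line[ℝ, c, d] := by
  obtain ⟨x, hx, y, hy, hxy⟩ := exists_two_of_infinite h
  rw [← affineSpan_pair_eq_of_mem_of_mem_of_ne (seg_sub_line a b hx.1) (seg_sub_line a b hy.1) hxy,
    ← affineSpan_pair_eq_of_mem_of_mem_of_ne (seg_sub_line c d hx.2) (seg_sub_line c d hy.2) hxy]

/-- A segment overlapping `[c,d]` contains an inward end germ of `[c,d]` or is inside `[c,d]`. -/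
lemma germ_or_subset {a b c d : ℝ × ℝ} 
    (h : (segment ℝ a b ∩ segment ℝ c d).Infinite) :
    HasGerm (segment ℝ a b) c (d - c) ∨ HasGerm (segment ℝ a b) d (c - d) ∨
      segment ℝ a b ⊆ segment ℝ c d := by
  have hl := line_eq_of_overlap h
  have ha : a ∈ line[ℝ, c, d] := hl ▸ left_mem_affineSpan_pair ℝ a b
  have hb : b ∈ line[ℝ, c, d] := hl ▸ right_mem_affineSpan_pair ℝ a b
  rw [mem_affineSpan_pair_iff_exists_lineMap_eq] at ha hb
  obtain ⟨α, rfl⟩ := ha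
  obtain ⟨β, rfl⟩ := hb
  clear hl
  wlog hαβ : α ≤ β generalizing α β with H
  · have := H β α (by rwa [segment_symm]) (le_of_not_ge hαβ)
    rwa [segment_symm ℝ (lineMap c d β)] at this
  rw [← image_segment] at h ⊢
  have hcd : segment ℝ c d = lineMap c d '' (Icc (0:ℝ) 1) := segment_eq_image_lineMap _ _ _
  rw [segment_eq_Icc hαβ] at h ⊢
  rw [hcd] at h ⊢
  have hβ : 0 < β := by
    by_contra hβ
    apply h
    refine (Set.finite_singleton c).subset ?_
    rintro x ⟨⟨t, ht, rfl⟩, ⟨t', ht', e⟩⟩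
    have hne : c = d ∨ c ≠ d := em _
    rcases hne with rfl | hne
    · simp
    · have := lineMap_injective ℝ hne e
      have : t = 0 := by linarith [ht.1, ht.2, ht'.1]
      simp [this]
  have hα : α < 1 := by
    by_contra hα
    apply h
    refine (Set.finite_singleton d).subset ?_
    rintro x ⟨⟨t, ht, rfl⟩, ⟨t', ht', e⟩⟩
    have hne : c = d ∨ c ≠ d := em _
    rcases hne with rfl | hne
    · simp
    · have := lineMap_injective ℝ hne e
      have : t = 1 := by linarith [ht.1, ht.2, ht'.2]
      simp [this]
  by_cases h1 : α ≤ 0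
  · left
    refine ⟨β, hβ, fun t h0 ht => ⟨t, ⟨by linarith, ht⟩, ?_⟩⟩
    rw [lineMap_apply_module']; abel
  by_cases h2 : 1 ≤ β
  · right; left
    refine ⟨1 - α, by linarith, fun t h0 ht => ⟨1 - t, ⟨by linarith, by linarith⟩, ?_⟩⟩
    rw [lineMap_apply_module']; module
  · right; right
    apply image_mono
    apply Icc_subset_Icc <;> linarith

/-- The segments of a path. -/
structure Dec (P : Set (ℝ × ℝ)) (D : Set (Submodule ℝ (ℝ × ℝ))) where
  a : Fin 3 → ℝ × ℝ
  b : Fin 3 → ℝ × ℝ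
  ne : ∀ k, a k ≠ b k
  dir : ∀ k, segDir (a k) (b k) ∈ D
  eq : P = ⋃ k, segment ℝ (a k) (b k)
  corner : (a 1 = a 2 ∧ b 1 = b 2) ∨ (b 0 = a 1 ∧ b 1 = a 2 ∧
    segDir (a 0) (b 0) ≠ segDir (a 1) (b 1) ∧ segDir (a 1) (b 1) ≠ segDir (a 2) (b 2))

lemma segDir_ne {p q r : ℝ × ℝ} (h : ¬ Collinear ℝ ({p, q, r} : Set (ℝ × ℝ))) :
    segDir p q ≠ segDir q r := by
  intro e
  apply h
  have hr : r - q ∈ segDir p q := by rw [e]; exact Submodule.mem_span_singleton_self _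
  obtain ⟨c, hc⟩ := Submodule.mem_span_singleton.1 hr
  rw [collinear_iff_of_mem (p₀ := q) (by simp)]
  refine ⟨q - p, ?_⟩
  rintro x (rfl | rfl | rfl)
  · exact ⟨-1, by simp⟩
  · exact ⟨0, by simp⟩
  · exact ⟨c, by rw [hc]; simp⟩

lemma exists_dec {P : Set (ℝ × ℝ)} {D : Set (Submodule ℝ (ℝ × ℝ))} (h : Un2BendWithDirs P D) :
    Nonempty (Dec P D) := by
  rcases h with ⟨p, q, hpq, hD, e⟩ | ⟨p, q, r, hpq, hqr, hc, hD, hD', e⟩ |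
    ⟨p, q, r, s, hpq, hqr, hrs, hc, hc', hD, hD', hD'', e⟩
  · refine ⟨⟨![p, p, p], ![q, q, q], ?_, ?_, ?_, Or.inl ⟨rfl, rfl⟩⟩⟩
    · intro k; fin_cases k <;> simpa
    · intro k; fin_cases k <;> simpa
    · rw [e]; ext x; simp [Fin.exists_fin_succ]
  · refine ⟨⟨![p, q, q], ![q, r, r], ?_, ?_, ?_, Or.inl ⟨rfl, rfl⟩⟩⟩
    · intro k; fin_cases k <;> simpa
    · intro k; fin_cases k <;> simpa
    · rw [e]; ext x; simp [Fin.exists_fin_succ]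
  · refine ⟨⟨![p, q, r], ![q, r, s], ?_, ?_, ?_,
      Or.inr ⟨rfl, rfl, segDir_ne hc, segDir_ne hc'⟩⟩⟩
    · intro k; fin_cases k <;> simpa
    · intro k; fin_cases k <;> simpa
    · rw [e]; ext x; simp [Fin.exists_fin_succ, or_assoc]

namespace Dec

variable {P Q : Set (ℝ × ℝ)} {D : Set (Submodule ℝ (ℝ × ℝ))}

/-- The `k`-th segment. -/
def seg (d : Dec P D) (k : Fin 3) : Set (ℝ × ℝ) := segment ℝ (d.a k) (d.b k)

/-- The line through the `k`-th segment. -/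
noncomputable def ln (d : Dec P D) (k : Fin 3) : AffineSubspace ℝ (ℝ × ℝ) :=
  line[ℝ, d.a k, d.b k]

lemma seg_subset (d : Dec P D) (k : Fin 3) : d.seg k ⊆ P := by
  conv_rhs => rw [d.eq]
  exact subset_iUnion (fun k => segment ℝ (d.a k) (d.b k)) k

lemma ln_dir (d : Dec P D) (k : Fin 3) : (d.ln k).direction = segDir (d.a k) (d.b k) := by
  rw [ln, direction_affineSpan, vectorSpan_pair_rev]; rfl

/-- If `P` overlaps `S` then some segment of `P` does. -/
lemma exists_seg (d : Dec P D) {S : Set (ℝ × ℝ)} (h : (P ∩ S).Infinite) :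
    ∃ k, (d.seg k ∩ S).Infinite := by
  by_contra! hc
  apply h
  rw [d.eq, iUnion_inter]
  exact finite_iUnion (fun k => by simpa [seg] using hc k)

/-- If `P` overlaps `S` then some segment of `P` does. -/
lemma exists_seg' (d : Dec P D) {S : Set (ℝ × ℝ)} (h : (S ∩ P).Infinite) :
    ∃ k, (S ∩ d.seg k).Infinite := by
  rw [inter_comm] at h
  obtain ⟨k, hk⟩ := d.exists_seg h
  exact ⟨k, by rwa [inter_comm]⟩

end Dec

/-- End germs of the segments of a path. -/
noncomputable def endPt {P : Set (ℝ × ℝ)} {D : Set (Submodule ℝ (ℝ × ℝ))} (d : Dec P D)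
    (k : Fin 3) (s : Bool) : ℝ × ℝ := if s then d.a k else d.b k

/-- End germs of the segments of a path. -/
noncomputable def endVec {P : Set (ℝ × ℝ)} {D : Set (Submodule ℝ (ℝ × ℝ))} (d : Dec P D)
    (k : Fin 3) (s : Bool) : ℝ × ℝ := if s then d.b k - d.a k else d.a k - d.b k

lemma endVec_ne {P : Set (ℝ × ℝ)} {D : Set (Submodule ℝ (ℝ × ℝ))} (d : Dec P D)
    (k : Fin 3) (s : Bool) : endVec d k s ≠ 0 := by
  have := d.ne k
  cases s <;> simp [endVec, sub_eq_zero, this, this.symm]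

/-- `P` is bad for the family `W`: one of its segments overlaps two members of the family. -/
def Bad {P : Set (ℝ × ℝ)} {D : Set (Submodule ℝ (ℝ × ℝ))} (d : Dec P D) {ω : Type*}
    (W : ω → Set (ℝ × ℝ)) : Prop :=
  ∃ k w w', w ≠ w' ∧ (d.seg k ∩ W w).Infinite ∧ (d.seg k ∩ W w').Infinite

lemma bad_germ {P : Set (ℝ × ℝ)} {D : Set (Submodule ℝ (ℝ × ℝ))} {d : Dec P D} {ω : Type*}
    {W : ω → Set (ℝ × ℝ)} (dW : ∀ w, Dec (W w) D)
    (hW : ∀ w w', w ≠ w' → ¬ (W w ∩ W w').Infinite) (h : Bad d W) :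
    ∃ g : ω × Fin 3 × Bool,
      HasGerm P (endPt (dW g.1) g.2.1 g.2.2) (endVec (dW g.1) g.2.1 g.2.2) := by
  obtain ⟨k, w, w', hne, h1, h2⟩ := h
  obtain ⟨j, hj⟩ := (dW w).exists_seg' h1
  rcases germ_or_subset hj with h3 | h3 | h3
  · exact ⟨(w, j, true), by simpa [endPt, endVec] using h3.mono (d.seg_subset k)⟩
  · exact ⟨(w, j, false), by simpa [endPt, endVec] using h3.mono (d.seg_subset k)⟩
  · exact absurd (h2.mono (inter_subset_inter_left _ (h3.trans ((dW w).seg_subset j)))) (hW w w' hne)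

open Classical in
lemma card_bad {D : Set (Submodule ℝ (ℝ × ℝ))} {ι ω : Type*} [Fintype ι] [Fintype ω]
    {U : ι → Set (ℝ × ℝ)} (dU : ∀ i, Dec (U i) D) (hU : ∀ i j, i ≠ j → ¬ (U i ∩ U j).Infinite)
    {W : ω → Set (ℝ × ℝ)} (dW : ∀ w, Dec (W w) D)
    (hW : ∀ w w', w ≠ w' → ¬ (W w ∩ W w').Infinite) :
    (Finset.univ.filter (fun i => Bad (dU i) W)).card ≤ 6 * Fintype.card ω := by
  have key : ∀ i : {i // Bad (dU i) W}, ∃ g : ω × Fin 3 × Bool,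
      HasGerm (U i) (endPt (dW g.1) g.2.1 g.2.2) (endVec (dW g.1) g.2.1 g.2.2) :=
    fun i => bad_germ dW hW i.2
  choose g hg using key
  have inj : Function.Injective g := by
    intro i j hij
    by_contra hne
    have h1 := hg i
    rw [hij] at h1
    exact hU i j (fun h => hne (Subtype.ext h)) (h1.inter_infinite (hg j) (endVec_ne _ _ _))
  have := Fintype.card_le_of_injective g inj
  rw [Fintype.card_subtype] at this
  simp only [Fintype.card_prod, Fintype.card_fin, Fintype.card_bool] at this
  omega


/-- `P` contains, at the crossing point of `l` and `l'`, a germ along `l` with orientation `s`. -/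
def Cr (P : Set (ℝ × ℝ)) (l l' : AffineSubspace ℝ (ℝ × ℝ)) (s : Bool) : Prop :=
  ∃ x v, x ∈ l ∧ x ∈ l' ∧ v ≠ 0 ∧ v ∈ l.direction ∧ (s = true ↔ Pos v) ∧ HasGerm P x v

lemma cr_overlap {P Q : Set (ℝ × ℝ)} {p q p' q' : ℝ × ℝ} {s : Bool}
    (hd : line[ℝ, p, q].direction ≠ line[ℝ, p', q'].direction)
    (h : Cr P line[ℝ, p, q] line[ℝ, p', q'] s) (h' : Cr Q line[ℝ, p, q] line[ℝ, p', q'] s) :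
    (P ∩ Q).Infinite := by
  obtain ⟨x, v, hx, hx', hv, hvd, hs, hg⟩ := h
  obtain ⟨y, w, hy, hy', hw, hwd, hs', hg'⟩ := h'
  have hxy : x = y := by
    by_contra hxy
    apply hd
    rw [← affineSpan_pair_eq_of_mem_of_mem_of_ne hx hy hxy,
      ← affineSpan_pair_eq_of_mem_of_mem_of_ne hx' hy' hxy]
  subst hxy
  rw [direction_affineSpan, vectorSpan_pair_rev] at hvd hwd
  obtain ⟨c, hc, rfl⟩ := pos_parallel hvd hwd hv hw (hs.symm.trans hs')
  exact (hg.scale hc).inter_infinite hg' hw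

open Classical in
lemma cr_exists {P : Set (ℝ × ℝ)} {l l' : AffineSubspace ℝ (ℝ × ℝ)} {x v : ℝ × ℝ}
    (hx : x ∈ l) (hx' : x ∈ l') (hv : v ≠ 0) (hvd : v ∈ l.direction) (hg : HasGerm P x v) :
    Cr P l l' (decide (Pos v)) := ⟨x, v, hx, hx', hv, hvd, by simp, hg⟩

open Classical in
/-- Number of same-colour pairs. -/
lemma par_bound {L Δ : Type*} (S : Finset L) (T : Finset Δ) (c : L → Δ)
    (hc : ∀ l ∈ S, c l ∈ T) :
    S.card ^ 2 ≤ T.card * ((S ×ˢ S).filter (fun x => c x.1 = c x.2)).card := by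
  have h1 : S.card = ∑ t ∈ T, (S.filter (fun l => c l = t)).card :=
    Finset.card_eq_sum_card_fiberwise hc
  have h2 : ((S ×ˢ S).filter (fun x => c x.1 = c x.2)).card
      = ∑ t ∈ T, (S.filter (fun l => c l = t)).card ^ 2 := by
    rw [Finset.card_eq_sum_card_fiberwise (f := fun x => c x.1) (t := T)]
    · apply Finset.sum_congr rfl
      intro t _
      rw [sq, ← Finset.card_product]
      congr 1
      ext ⟨a, b⟩
      simp only [Finset.mem_filter, Finset.mem_product]
      constructor
      · rintro ⟨⟨⟨h1, h2⟩, h3⟩, h4⟩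
        exact ⟨⟨h1, h4⟩, h2, h3 ▸ h4⟩
      · rintro ⟨⟨h1, h4⟩, h2, h3⟩
        exact ⟨⟨⟨h1, h2⟩, h4.trans h3.symm⟩, h4⟩
    · intro x hx
      simp only [Finset.coe_filter, Finset.mem_product, mem_ofPred_eq] at hx
      exact hc _ hx.1.1
  rw [h2]
  conv_lhs => rw [h1]
  exact sq_sum_le_card_mul_sum_sq

/-- A good path contributes four crossing germs. -/
lemma four_le {P : Set (ℝ × ℝ)} {D : Set (Submodule ℝ (ℝ × ℝ))} (d : Dec P D)
    (hc : d.b 0 = d.a 1 ∧ d.b 1 = d.a 2 ∧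
      segDir (d.a 0) (d.b 0) ≠ segDir (d.a 1) (d.b 1) ∧
      segDir (d.a 1) (d.b 1) ≠ segDir (d.a 2) (d.b 2))
    (S : Finset (AffineSubspace ℝ (ℝ × ℝ) × AffineSubspace ℝ (ℝ × ℝ) × Bool))
    (hS : ∀ i j s, (d.ln i).direction ≠ (d.ln j).direction → Cr P (d.ln i) (d.ln j) s →
      (d.ln i, d.ln j, s) ∈ S) : 4 ≤ S.card := by
  classical
  obtain ⟨h01, h12, hd1, hd2⟩ := hc
  rw [← d.ln_dir, ← d.ln_dir] at hd1 hd2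
  have hq0 : d.a 1 ∈ d.ln 0 := h01 ▸ right_mem_affineSpan_pair ℝ _ _
  have hq1 : d.a 1 ∈ d.ln 1 := left_mem_affineSpan_pair ℝ _ _
  have hr1 : d.a 2 ∈ d.ln 1 := h12 ▸ right_mem_affineSpan_pair ℝ _ _
  have hr2 : d.a 2 ∈ d.ln 2 := left_mem_affineSpan_pair ℝ _ _
  have hqr : d.a 1 ≠ d.a 2 := h12 ▸ d.ne 1
  have hv0 : d.a 0 - d.a 1 ∈ (d.ln 0).direction :=
    AffineSubspace.vsub_mem_direction (left_mem_affineSpan_pair ℝ _ _) hq0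
  have hv1 : d.a 2 - d.a 1 ∈ (d.ln 1).direction := AffineSubspace.vsub_mem_direction hr1 hq1
  have hv1' : d.a 1 - d.a 2 ∈ (d.ln 1).direction := AffineSubspace.vsub_mem_direction hq1 hr1
  have hv2 : d.b 2 - d.a 2 ∈ (d.ln 2).direction :=
    AffineSubspace.vsub_mem_direction (right_mem_affineSpan_pair ℝ _ _) hr2
  have g0 : HasGerm P (d.a 1) (d.a 0 - d.a 1) := by
    have := germ_right (d.a 0) (d.b 0)
    rw [h01] at this
    exact this.mono (by simpa [Dec.seg, h01] using d.seg_subset 0)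
  have g1 : HasGerm P (d.a 1) (d.a 2 - d.a 1) := by
    have := germ_left (d.a 1) (d.b 1)
    rw [h12] at this
    exact this.mono (by simpa [Dec.seg, h12] using d.seg_subset 1)
  have g1' : HasGerm P (d.a 2) (d.a 1 - d.a 2) := by
    have := germ_right (d.a 1) (d.b 1)
    rw [h12] at this
    exact this.mono (by simpa [Dec.seg, h12] using d.seg_subset 1)
  have g2 : HasGerm P (d.a 2) (d.b 2 - d.a 2) := (germ_left _ _).mono (d.seg_subset 2)
  have n0 : d.a 0 - d.a 1 ≠ 0 := sub_ne_zero.2 (h01 ▸ d.ne 0)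
  have n1 : d.a 2 - d.a 1 ≠ 0 := sub_ne_zero.2 hqr.symm
  have n1' : d.a 1 - d.a 2 ≠ 0 := sub_ne_zero.2 hqr
  have n2 : d.b 2 - d.a 2 ≠ 0 := sub_ne_zero.2 (d.ne 2).symm
  have e1 := hS _ _ _ hd1 (cr_exists hq0 hq1 n0 hv0 g0)
  have e2 := hS _ _ _ hd1.symm (cr_exists hq1 hq0 n1 hv1 g1)
  have e3 := hS _ _ _ hd2 (cr_exists hr1 hr2 n1' hv1' g1')
  have e4 := hS _ _ _ hd2.symm (cr_exists hr2 hr1 n2 hv2 g2)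
  have h02 : d.ln 0 ≠ d.ln 2 := by
    intro h
    apply hd1
    have hr0 : d.a 2 ∈ d.ln 0 := h ▸ hr2
    have a1 : line[ℝ, d.a 1, d.a 2] = d.ln 0 :=
      affineSpan_pair_eq_of_mem_of_mem_of_ne hq0 hr0 hqr
    have a2 : line[ℝ, d.a 1, d.a 2] = d.ln 1 :=
      affineSpan_pair_eq_of_mem_of_mem_of_ne hq1 hr1 hqr
    rw [← a1, ← a2]
  have h01' : d.ln 0 ≠ d.ln 1 := fun h => hd1 (by rw [h])
  have h12' : d.ln 1 ≠ d.ln 2 := fun h => hd2 (by rw [h])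
  set s1 := decide (Pos (d.a 0 - d.a 1))
  set s2 := decide (Pos (d.a 2 - d.a 1))
  set s3 := decide (Pos (d.a 1 - d.a 2))
  set s4 := decide (Pos (d.b 2 - d.a 2))
  have hsub : ({(d.ln 0, d.ln 1, s1), (d.ln 1, d.ln 0, s2), (d.ln 1, d.ln 2, s3),
      (d.ln 2, d.ln 1, s4)} : Finset _) ⊆ S := by
    intro x hx
    simp only [Finset.mem_insert, Finset.mem_singleton] at hx
    rcases hx with rfl | rfl | rfl | rfl <;> assumption
  refine le_trans (le_of_eq ?_) (Finset.card_le_card hsub)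
  rw [Finset.card_insert_of_notMem, Finset.card_insert_of_notMem, Finset.card_insert_of_notMem,
    Finset.card_singleton]
  · simp [h12', h12'.symm]
  · simp [h02, h12']
  · simp [h01', h02]

theorem lower {D : Set (Submodule ℝ (ℝ × ℝ))} (hD : D.Finite) {α β : Type*} [Fintype α] [Fintype β]
    (Y : Bool → Set (ℝ × ℝ)) (A : α → Set (ℝ × ℝ)) (B : β → Set (ℝ × ℝ))
    (dY : ∀ i, Un2BendWithDirs (Y i) D) (dA : ∀ i, Un2BendWithDirs (A i) D)
    (dB : ∀ i, Un2BendWithDirs (B i) D)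
    (hY : ∀ i j, i ≠ j → ¬ (Y i ∩ Y j).Infinite)
    (hA : ∀ i j, i ≠ j → ¬ (A i ∩ A j).Infinite)
    (hB : ∀ i j, i ≠ j → ¬ (B i ∩ B j).Infinite)
    (hAY : ∀ i y, (A i ∩ Y y).Infinite)
    (tri : β → Fin 3 → α) (htri : ∀ b, Function.Injective (tri b))
    (hBA : ∀ b k, (B b ∩ A (tri b k)).Infinite) :
    ∃ L par : ℕ, L ≤ Fintype.card α + 42 ∧ L ^ 2 ≤ D.ncard * par ∧ par ≤ L ^ 2 ∧
      2 * Fintype.card β + par ≤ L ^ 2 + 12 * Fintype.card α := by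
  classical
  replace dY := fun i => (exists_dec (dY i)).some
  replace dA := fun i => (exists_dec (dA i)).some
  replace dB := fun i => (exists_dec (dB i)).some
  -- the set of lines
  let LL : Finset (AffineSubspace ℝ (ℝ × ℝ)) :=
    Finset.univ.image (fun x : α × Fin 3 => (dA x.1).ln x.2)
  let L0 : Finset (AffineSubspace ℝ (ℝ × ℝ)) :=
    Finset.univ.image (fun x : Bool × Fin 3 => (dY x.1).ln x.2)
  have hL0 : L0.card ≤ 6 := by
    refine Finset.card_image_le.trans ?_
    simp
  let bad : Finset α := Finset.univ.filter (fun i => Bad (dA i) Y)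
  have hbad : bad.card ≤ 12 := by
    simpa using card_bad dA hA dY hY
  have own : ∀ i, ∃ l, i ∉ bad → ∀ k, (dA i).ln k ∈ L0 ∨ (dA i).ln k = l := by
    intro i
    by_cases hi : i ∈ bad
    · exact ⟨⊤, fun h => absurd hi h⟩
    have hi' : ¬ Bad (dA i) Y := by simpa [bad] using hi
    choose e he using fun y => (dA i).exists_seg (hAY i y)
    have hL : ∀ y, (dA i).ln (e y) ∈ L0 := by
      intro y
      obtain ⟨j, hj⟩ := (dY y).exists_seg' (he y)
      have := line_eq_of_overlap hj
      exact Finset.mem_image.2 ⟨(y, j), Finset.mem_univ _, this.symm⟩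
    have hne : e true ≠ e false := by
      intro h
      exact hi' ⟨e true, true, false, by simp, he true, h ▸ he false⟩
    have h3 : ∃ k0 : Fin 3, ∀ k, k = e true ∨ k = e false ∨ k = k0 := by
      generalize e true = x at hne
      generalize e false = y at hne
      revert x y
      decide
    obtain ⟨k0, hk0⟩ := h3
    refine ⟨(dA i).ln k0, fun _ k => ?_⟩
    rcases hk0 k with rfl | rfl | rfl
    · exact Or.inl (hL _)
    · exact Or.inl (hL _)
    · exact Or.inr rfl
  choose own hown using own
  have hLsub : LL ⊆ L0 ∪ (Finset.univ.image own ∪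
      (bad ×ˢ Finset.univ).image (fun x : α × Fin 3 => (dA x.1).ln x.2)) := by
    intro l hl
    obtain ⟨⟨i, k⟩, _, rfl⟩ := Finset.mem_image.1 hl
    by_cases hi : i ∈ bad
    · refine Finset.mem_union_right _ (Finset.mem_union_right _ ?_)
      exact Finset.mem_image.2 ⟨(i, k), by simp [hi], rfl⟩
    · rcases hown i hi k with h | h
      · exact Finset.mem_union_left _ h
      · refine Finset.mem_union_right _ (Finset.mem_union_left _ ?_)
        exact Finset.mem_image.2 ⟨i, Finset.mem_univ _, h.symm⟩
  have hLcard : LL.card ≤ Fintype.card α + 42 := by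
    refine (Finset.card_le_card hLsub).trans ?_
    refine (Finset.card_union_le _ _).trans ?_
    have h1 := Finset.card_union_le (Finset.univ.image own)
      ((bad ×ˢ Finset.univ).image (fun x : α × Fin 3 => (dA x.1).ln x.2))
    have h2 : (Finset.univ.image own).card ≤ Fintype.card α := Finset.card_image_le
    have h3 : ((bad ×ˢ Finset.univ).image (fun x : α × Fin 3 => (dA x.1).ln x.2)).card
        ≤ bad.card * 3 := by
      refine Finset.card_image_le.trans ?_
      simp
    omega
  -- directions
  let par := (LL ×ˢ LL).filter (fun x => x.1.direction = x.2.direction)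
  have hpar : LL.card ^ 2 ≤ D.ncard * par.card := by
    rw [ncard_eq_toFinset_card D hD]
    apply par_bound LL hD.toFinset (fun l => l.direction)
    intro l hl
    obtain ⟨⟨i, k⟩, _, rfl⟩ := Finset.mem_image.1 hl
    simp only [Finite.mem_toFinset]
    rw [Dec.ln_dir]
    exact (dA i).dir k
  have hparle : par.card ≤ LL.card ^ 2 := by
    refine (Finset.card_filter_le _ _).trans ?_
    rw [Finset.card_product, sq]
  let np := (LL ×ˢ LL).filter (fun x => ¬ (x.1.direction = x.2.direction))
  have hnp : par.card + np.card = LL.card ^ 2 := by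
    rw [Finset.card_filter_add_card_filter_not, Finset.card_product, sq]
  -- bad B
  let badB : Finset β := Finset.univ.filter (fun i => Bad (dB i) A)
  have hbadB : badB.card ≤ 6 * Fintype.card α := card_bad dB hB dA hA
  let goodB : Finset β := Finset.univ.filter (fun i => ¬ Bad (dB i) A)
  have hgb : badB.card + goodB.card = Fintype.card β := by
    rw [Finset.card_filter_add_card_filter_not, Finset.card_univ]
  let U : Finset (AffineSubspace ℝ (ℝ × ℝ) × AffineSubspace ℝ (ℝ × ℝ) × Bool) :=
    (LL ×ˢ (LL ×ˢ Finset.univ)).filter (fun x => ¬ (x.1.direction = x.2.1.direction))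
  have hU : U.card = np.card * 2 := by
    have : U.card = (np ×ˢ (Finset.univ : Finset Bool)).card := by
      apply Finset.card_bij (fun x _ => ((x.1, x.2.1), x.2.2))
      · intro x hx
        simp only [U, Finset.mem_filter, Finset.mem_product] at hx
        simp [np]
        tauto
      · rintro ⟨a, b, c⟩ _ ⟨a', b', c'⟩ _ h
        simp at h ⊢
        tauto
      · rintro ⟨⟨a, b⟩, c⟩ hx
        simp only [np, Finset.mem_filter, Finset.mem_product] at hx
        refine ⟨(a, b, c), ?_, rfl⟩
        simp [U]
        tauto
    rw [this, Finset.card_product]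
    simp
  let S : β → Finset (AffineSubspace ℝ (ℝ × ℝ) × AffineSubspace ℝ (ℝ × ℝ) × Bool) :=
    fun b => U.filter (fun x => Cr (B b) x.1 x.2.1 x.2.2)
  have hdisj : (goodB : Set β).PairwiseDisjoint S := by
    intro b _ b' _ hbb
    rw [Function.onFun, Finset.disjoint_left]
    rintro ⟨l, l', s⟩ hx hx'
    simp only [S, U, Finset.mem_filter, Finset.mem_product] at hx hx'
    obtain ⟨⟨⟨hl, hl', _⟩, hnp⟩, hcr⟩ := hx
    obtain ⟨_, hcr'⟩ := hx'
    obtain ⟨⟨i, k⟩, _, rfl⟩ := Finset.mem_image.1 hl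
    obtain ⟨⟨i', k'⟩, _, rfl⟩ := Finset.mem_image.1 hl'
    exact hB b b' hbb (cr_overlap hnp hcr hcr')
  have hfour : ∀ b ∈ goodB, 4 ≤ (S b).card := by
    intro b hb
    have hb' : ¬ Bad (dB b) A := by simpa [goodB] using hb
    choose e he using fun k => (dB b).exists_seg (hBA b k)
    have einj : Function.Injective e := by
      intro k k' h
      by_contra hne
      exact hb' ⟨e k, tri b k, tri b k', fun h' => hne (htri b h'), he k, h ▸ he k'⟩
    have esurj : Function.Surjective e := Finite.surjective_of_injective einj
    have hln : ∀ k, (dB b).ln k ∈ LL := by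
      intro k
      obtain ⟨j, rfl⟩ := esurj k
      obtain ⟨i, hi⟩ := (dA (tri b j)).exists_seg' (he j)
      exact Finset.mem_image.2 ⟨(tri b j, i), Finset.mem_univ _, (line_eq_of_overlap hi).symm⟩
    have hcorner := (dB b).corner
    rcases hcorner with ⟨ha, hb2⟩ | hcorner
    · exfalso
      obtain ⟨j1, hj1⟩ := esurj 1
      obtain ⟨j2, hj2⟩ := esurj 2
      have hne : j1 ≠ j2 := by
        rintro rfl
        rw [hj1] at hj2
        exact absurd hj2 (by decide)
      apply hb'
      refine ⟨1, tri b j1, tri b j2, fun h => hne (htri b h), hj1 ▸ he j1, ?_⟩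
      have := he j2
      rw [hj2, Dec.seg, ← ha, ← hb2] at this
      exact this
    · apply four_le (dB b) hcorner
      intro i j s hd hcr
      simp only [S, U, Finset.mem_filter, Finset.mem_product]
      exact ⟨⟨⟨hln i, hln j, Finset.mem_univ _⟩, hd⟩, hcr⟩
  have hsum : goodB.card * 4 ≤ U.card := by
    calc goodB.card * 4 ≤ ∑ b ∈ goodB, (S b).card := by
          simpa using Finset.card_nsmul_le_sum goodB (fun b => (S b).card) 4 hfour
      _ = (goodB.biUnion S).card := (Finset.card_biUnion hdisj).symm
      _ ≤ U.card := Finset.card_le_card (by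
          intro x hx
          obtain ⟨b, _, hb⟩ := Finset.mem_biUnion.1 hx
          exact (Finset.mem_filter.1 hb).1)
  refine ⟨LL.card, par.card, hLcard, hpar, hparle, ?_⟩
  omega


/-- The point with abscissa `x` on the tangent at `a` to the parabola `y = x ^ 2`. -/
def pt (a x : ℝ) : ℝ × ℝ := (x, 2 * a * x - a ^ 2)

lemma mem_seg_pt {a u w : ℝ} {p : ℝ × ℝ} :
    p ∈ segment ℝ (pt a u) (pt a w) ↔ p.1 ∈ uIcc u w ∧ p.2 = 2 * a * p.1 - a ^ 2 := by
  rw [← segment_eq_uIcc, segment_eq_image, segment_eq_image]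
  constructor
  · rintro ⟨t, ht, rfl⟩
    refine ⟨⟨t, ht, by simp [pt]⟩, ?_⟩
    simp [pt]; ring
  · rintro ⟨⟨t, ht, h1⟩, h2⟩
    refine ⟨t, ht, ?_⟩
    apply Prod.ext
    · simpa [pt] using h1
    · rw [h2, ← h1]
      simp [pt]; ring

lemma mem_seg_vert {c u w : ℝ} {p : ℝ × ℝ} :
    p ∈ segment ℝ (c, u) (c, w) ↔ p.1 = c ∧ p.2 ∈ uIcc u w := by
  rw [← segment_eq_uIcc, ← Prod.image_mk_segment_right]
  constructor
  · rintro ⟨t, ht, rfl⟩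
    exact ⟨rfl, ht⟩
  · rintro ⟨h1, h2⟩
    exact ⟨p.2, h2, by rw [← h1]⟩

lemma seg_pt_overlap {a a' u u' w w' : ℝ}
    (h : (segment ℝ (pt a u) (pt a w) ∩ segment ℝ (pt a' u') (pt a' w')).Infinite) :
    a = a' ∧ min u w < max u' w' ∧ min u' w' < max u w := by
  obtain ⟨x, ⟨hx, hx'⟩, y, ⟨hy, hy'⟩, hxy⟩ := exists_two_of_infinite h
  rw [mem_seg_pt] at hx hx' hy hy'
  have hne : x.1 ≠ y.1 := by
    intro h1
    apply hxy
    apply Prod.ext h1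
    rw [hx.2, hy.2, h1]
  constructor
  · by_contra haa
    have e1 : (a - a') * (2 * x.1 - a - a') = 0 := by linear_combination hx.2 - hx'.2 - 2 * hx.2 + 2 * hx'.2
    have e2 : (a - a') * (2 * y.1 - a - a') = 0 := by linear_combination hy.2 - hy'.2 - 2 * hy.2 + 2 * hy'.2
    have h0 : a - a' ≠ 0 := sub_ne_zero.2 haa
    have f1 := (mul_eq_zero.1 e1).resolve_left h0
    have f2 := (mul_eq_zero.1 e2).resolve_left h0
    apply hne; linarith
  · obtain ⟨⟨a1, a2⟩, -⟩ := hx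
    obtain ⟨⟨b1, b2⟩, -⟩ := hx'
    obtain ⟨⟨c1, c2⟩, -⟩ := hy
    obtain ⟨⟨d1, d2⟩, -⟩ := hy'
    rcases lt_or_gt_of_ne hne with h1 | h1
    · exact ⟨lt_of_le_of_lt a1 (lt_of_lt_of_le h1 d2), lt_of_le_of_lt b1 (lt_of_lt_of_le h1 c2)⟩
    · exact ⟨lt_of_le_of_lt c1 (lt_of_lt_of_le h1 b2), lt_of_le_of_lt d1 (lt_of_lt_of_le h1 a2)⟩

/-- A piece of a tangent line, with integer data. -/
def piece (a U W : ℤ) : Set (ℝ × ℝ) := segment ℝ (pt a (U / 8)) (pt a (W / 8))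

lemma piece_overlap {a a' U U' W W' : ℤ} (h : (piece a U W ∩ piece a' U' W').Infinite) :
    a = a' ∧ min U W < max U' W' ∧ min U' W' < max U W := by
  obtain ⟨h1, h2, h3⟩ := seg_pt_overlap h
  have key : ∀ A B C E : ℤ, min ((A : ℝ) / 8) (B / 8) < max ((C : ℝ) / 8) (E / 8) →
      min A B < max C E := by
    intro A B C E h
    simp only [min_lt_iff, lt_max_iff] at h ⊢
    have : ∀ x y : ℤ, (x : ℝ) / 8 < (y : ℝ) / 8 → x < y := by
      intro x y hxy
      have : (x : ℝ) < y := by linarith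
      exact_mod_cast this
    rcases h with (h | h) | (h | h)
    · exact Or.inl (Or.inl (this _ _ h))
    · exact Or.inl (Or.inr (this _ _ h))
    · exact Or.inr (Or.inl (this _ _ h))
    · exact Or.inr (Or.inr (this _ _ h))
  exact ⟨by exact_mod_cast h1, key _ _ _ _ h2, key _ _ _ _ h3⟩

lemma piece_infinite {a U W : ℤ} (h : U ≠ W) : (piece a U W).Infinite := by
  have hne : pt a (U / 8) ≠ pt a (W / 8) := by
    intro e
    have := congrArg Prod.fst e
    simp only [pt] at this
    apply h
    have : (U : ℝ) = W := by linarith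
    exact_mod_cast this
  have := (germ_left (pt a (U / 8)) (pt a (W / 8)))
  have := this.inter_infinite this (sub_ne_zero.2 hne.symm)
  rwa [inter_self] at this

lemma not_collinear {p q r : ℝ × ℝ}
    (h : (q.1 - p.1) * (r.2 - q.2) ≠ (q.2 - p.2) * (r.1 - q.1)) :
    ¬ Collinear ℝ ({p, q, r} : Set (ℝ × ℝ)) := by
  intro hc
  rw [collinear_iff_of_mem (p₀ := q) (by simp)] at hc
  obtain ⟨v, hv⟩ := hc
  obtain ⟨s, hs⟩ := hv p (by simp)
  obtain ⟨t, ht⟩ := hv r (by simp)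
  apply h
  rw [hs, ht]
  simp
  ring

/-- The sign attached to `i`. -/
def sg (i : ℤ) : ℤ := 1 - 2 * (i % 2)

/-- The path `B_{i,k}`. -/
def bP (i k : ℤ) : Set (ℝ × ℝ) :=
  piece (2 * k) (4 * (i + 2 * k) - sg i) (4 * (i + 2 * k)) ∪
  piece i (4 * (i + 2 * k)) (4 * (i + 2 * k + 1)) ∪
  piece (2 * k + 1) (4 * (i + 2 * k + 1)) (4 * (i + 2 * k + 1) - sg i)

lemma pt_cross (a b : ℝ) : pt a ((a + b) / 2) = pt b ((a + b) / 2) := by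
  simp only [pt, Prod.mk.injEq, true_and]; ring

lemma sg_cast_ne (i : ℤ) : ((sg i : ℤ) : ℝ) ≠ 0 := by
  have : sg i ≠ 0 := by unfold sg; omega
  exact_mod_cast this

lemma bP_path (i k : ℤ) (h0 : i ≠ 2 * k) (h1 : i ≠ 2 * k + 1) : IsUn2BendPath (bP i k) := by
  have hs := sg_cast_ne i
  have h0' : (2 * (k : ℝ) - i) ≠ 0 := by
    intro h; apply h0
    have : (i : ℝ) = 2 * k := by linarith
    exact_mod_cast this
  have h1' : (2 * (k : ℝ) + 1 - i) ≠ 0 := by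
    intro h; apply h1
    have : (i : ℝ) = 2 * k + 1 := by linarith
    exact_mod_cast this
  right; right
  refine ⟨pt (2 * k) ((4 * (i + 2 * k) - sg i) / 8), pt i ((i + 2 * k) / 2),
    pt i ((i + (2 * k + 1)) / 2), pt (2 * k + 1) ((4 * (i + 2 * k + 1) - sg i) / 8),
    ?_, ?_, ?_, ?_, ?_, ?_⟩
  · intro e
    have := congrArg Prod.fst e
    simp only [pt] at this
    apply hs; linarith
  · intro e
    have := congrArg Prod.fst e
    simp only [pt] at this
    linarith
  · intro e
    have := congrArg Prod.fst e
    simp only [pt] at this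
    apply hs; linarith
  · apply not_collinear
    rw [pt_cross (i : ℝ) (2 * k), ← sub_ne_zero]
    simp only [pt]
    have : ∀ z : ℝ, z = (sg i) * (2 * k - i) * (-1/8) → z ≠ 0 := by
      rintro z rfl
      have := mul_ne_zero hs h0'
      exact mul_ne_zero this (by norm_num)
    apply this
    ring
  · apply not_collinear
    rw [pt_cross (i : ℝ) (2 * k + 1), ← sub_ne_zero]
    simp only [pt]
    have : ∀ z : ℝ, z = (sg i) * (2 * k + 1 - i) * (-1/8) → z ≠ 0 := by
      rintro z rfl
      have := mul_ne_zero hs h1'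
      exact mul_ne_zero this (by norm_num)
    apply this
    ring
  · have e1 : ((4 * (i + 2 * k) : ℤ) : ℝ) / 8 = (i + 2 * k) / 2 := by push_cast; ring
    have e2 : ((4 * (i + 2 * k + 1) : ℤ) : ℝ) / 8 = (i + (2 * k + 1)) / 2 := by push_cast; ring
    have e3 : ((4 * (i + 2 * k) - sg i : ℤ) : ℝ) / 8 = (4 * (i + 2 * k) - sg i) / 8 := by
      push_cast; ring
    have e4 : ((4 * (i + 2 * k + 1) - sg i : ℤ) : ℝ) / 8 = (4 * (i + 2 * k + 1) - sg i) / 8 := by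
      push_cast; ring
    have f1 : ((2 * k : ℤ) : ℝ) = 2 * k := by push_cast; ring
    have f2 : ((2 * k + 1 : ℤ) : ℝ) = 2 * k + 1 := by push_cast; ring
    unfold bP piece
    rw [e1, e2, e3, e4, f1, f2, ← pt_cross (i : ℝ) (2 * k), ← pt_cross (i : ℝ) (2 * k + 1)]

lemma infinite_union_left {S T R : Set (ℝ × ℝ)} (h : ((S ∪ T) ∩ R).Infinite) :
    (S ∩ R).Infinite ∨ (T ∩ R).Infinite := by
  rwa [union_inter_distrib_right, infinite_union] at h

lemma infinite_union_right {S T R : Set (ℝ × ℝ)} (h : (R ∩ (S ∪ T)).Infinite) :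
    (R ∩ S).Infinite ∨ (R ∩ T).Infinite := by
  rwa [inter_union_distrib_left, infinite_union] at h

lemma bP_disj {i k i' k' : ℤ} (h0 : i ≠ 2 * k) (h1 : i ≠ 2 * k + 1)
    (h0' : i' ≠ 2 * k') (h1' : i' ≠ 2 * k' + 1)
    (h : (bP i k ∩ bP i' k').Infinite) : i = i' ∧ k = k' := by
  unfold bP at h
  rcases infinite_union_left h with h | h
  rcases infinite_union_left h with h | h
  all_goals
    rcases infinite_union_right h with h | h
    rcases infinite_union_right h with h | h
    all_goals
      have h2 := piece_overlap h
      clear h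
      try simp only [sg] at h2
      omega

/-- The path `A_i`. -/
def aP (R i : ℤ) : Set (ℝ × ℝ) :=
  segment ℝ ((-1 : ℝ), (((-2 * i - i ^ 2 : ℤ) : ℝ) + 1 / 2)) ((-1 : ℝ), ((-2 * i - i ^ 2 : ℤ) : ℝ)) ∪
  segment ℝ (pt i (-1)) (pt i R) ∪
  segment ℝ ((R : ℝ), ((2 * i * R - i ^ 2 : ℤ) : ℝ)) ((R : ℝ), ((2 * i * R - i ^ 2 : ℤ) : ℝ) + 1 / 2)

lemma pt_left (i : ℤ) : pt i (-1) = ((-1 : ℝ), ((-2 * i - i ^ 2 : ℤ) : ℝ)) := by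
  simp only [pt, Prod.mk.injEq, true_and]; push_cast; ring

lemma pt_right (i R : ℤ) : pt i R = ((R : ℝ), ((2 * i * R - i ^ 2 : ℤ) : ℝ)) := by
  simp only [pt, Prod.mk.injEq, true_and]; push_cast; ring

lemma aP_path {R : ℤ} (hR : 0 < R) (i : ℤ) : IsUn2BendPath (aP R i) := by
  have hR' : (0 : ℝ) < R := by exact_mod_cast hR
  right; right
  refine ⟨((-1 : ℝ), (((-2 * i - i ^ 2 : ℤ) : ℝ) + 1 / 2)), ((-1 : ℝ), ((-2 * i - i ^ 2 : ℤ) : ℝ)),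
    ((R : ℝ), ((2 * i * R - i ^ 2 : ℤ) : ℝ)), ((R : ℝ), ((2 * i * R - i ^ 2 : ℤ) : ℝ) + 1 / 2),
    ?_, ?_, ?_, ?_, ?_, ?_⟩
  rotate_left 5
  · unfold aP
    rw [pt_left, pt_right]
  · intro e
    have := congrArg Prod.snd e
    simp at this
  · intro e
    have := congrArg Prod.fst e
    simp at this
    linarith
  · intro e
    have := congrArg Prod.snd e
    simp at this
  · apply not_collinear
    simp only
    intro h
    ring_nf at h
    linarith
  · apply not_collinear
    simp only
    intro h
    ring_nf at h
    linarith

lemma unit_sep {a b : ℤ} {y : ℝ} (h1 : (a : ℝ) ≤ y) (h2 : y ≤ a + 1 / 2) (h3 : (b : ℝ) ≤ y)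
    (h4 : y ≤ b + 1 / 2) : a = b := by
  have a1 : (a : ℝ) < b + 1 := by linarith
  have a2 : (b : ℝ) < a + 1 := by linarith
  have b1 : a < b + 1 := by exact_mod_cast a1
  have b2 : b < a + 1 := by exact_mod_cast a2
  omega

lemma mem_aP {R i : ℤ} {p : ℝ × ℝ} (h : p ∈ aP R i) :
    (p.1 = -1 ∧ ((-2 * i - i ^ 2 : ℤ) : ℝ) ≤ p.2 ∧ p.2 ≤ ((-2 * i - i ^ 2 : ℤ) : ℝ) + 1 / 2) ∨
    (p.2 = 2 * i * p.1 - i ^ 2) ∨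
    (p.1 = R ∧ ((2 * i * R - i ^ 2 : ℤ) : ℝ) ≤ p.2 ∧
      p.2 ≤ ((2 * i * R - i ^ 2 : ℤ) : ℝ) + 1 / 2) := by
  unfold aP at h
  rcases h with (h | h) | h
  · rw [mem_seg_vert, uIcc_of_ge (by linarith)] at h
    exact Or.inl ⟨h.1, h.2.1, h.2.2⟩
  · rw [mem_seg_pt] at h
    exact Or.inr (Or.inl h.2)
  · rw [mem_seg_vert, uIcc_of_le (by linarith)] at h
    exact Or.inr (Or.inr ⟨h.1, h.2.1, h.2.2⟩)

lemma aP_disj {R i j : ℤ} (hi : 0 ≤ i) (hj : 0 ≤ j) (hiR : i < R) (hjR : j < R) (hij : i ≠ j) :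
    ¬ (aP R i ∩ aP R j).Infinite := by
  rw [not_infinite]
  have hfin : ({((-1 : ℝ), 2 * (i : ℝ) * (-1) - i ^ 2), ((-1 : ℝ), 2 * (j : ℝ) * (-1) - j ^ 2),
    ((R : ℝ), 2 * (i : ℝ) * R - i ^ 2), ((R : ℝ), 2 * (j : ℝ) * R - j ^ 2),
    (((i : ℝ) + j) / 2, 2 * (i : ℝ) * (((i : ℝ) + j) / 2) - i ^ 2)} : Set (ℝ × ℝ)).Finite := by
    simp
  have hR : (-1 : ℝ) ≠ R := by
    have : (-1 : ℤ) ≠ R := by omega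
    exact_mod_cast this
  have hijR : (i : ℝ) - j ≠ 0 := by
    have : i - j ≠ 0 := by omega
    exact_mod_cast this
  apply hfin.subset
  rintro ⟨x, y⟩ ⟨h1, h2⟩
  simp only [mem_insert_iff, mem_singleton_iff, Prod.mk.injEq]
  rcases mem_aP h1 with ⟨a1, a2, a3⟩ | a1 | ⟨a1, a2, a3⟩ <;>
  rcases mem_aP h2 with ⟨b1, b2, b3⟩ | b1 | ⟨b1, b2, b3⟩ <;> simp only at a1 b1
  · exfalso
    have := unit_sep a2 a3 b2 b3
    have h : (i - j) * (i + j + 2) = 0 := by linear_combination -this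
    rcases mul_eq_zero.1 h with h | h <;> omega
  · subst a1; right; left; exact ⟨rfl, b1⟩
  · exact absurd (a1.symm.trans b1) hR
  · subst b1; left; exact ⟨rfl, a1⟩
  · right; right; right; right
    have h : ((i : ℝ) - j) * (2 * x - i - j) = 0 := by linear_combination b1 - a1
    have := (mul_eq_zero.1 h).resolve_left hijR
    have hx : x = ((i : ℝ) + j) / 2 := by linarith
    subst hx
    exact ⟨rfl, a1⟩
  · subst b1; right; right; left; exact ⟨rfl, a1⟩
  · exact absurd (b1.symm.trans a1) hR
  · subst a1; right; right; right; left; exact ⟨rfl, b1⟩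
  · exfalso
    have := unit_sep a2 a3 b2 b3
    have h : (i - j) * (2 * R - i - j) = 0 := by linear_combination this
    rcases mul_eq_zero.1 h with h | h <;> omega

/-- The two pinning paths. -/
def yP (R : ℤ) (b : Bool) : Set (ℝ × ℝ) :=
  if b then segment ℝ ((-1 : ℝ), -(4 * (R : ℝ) ^ 2)) ((-1 : ℝ), 4 * (R : ℝ) ^ 2)
  else segment ℝ ((R : ℝ), -(4 * (R : ℝ) ^ 2)) ((R : ℝ), 4 * (R : ℝ) ^ 2)

lemma yP_path {R : ℤ} (hR : 0 < R) (b : Bool) : IsUn2BendPath (yP R b) := by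
  have hR' : (0 : ℝ) < R := by exact_mod_cast hR
  have h4 : 0 < 4 * (R : ℝ) ^ 2 := by positivity
  left
  cases b
  · refine ⟨_, _, ?_, rfl⟩
    intro e
    have := congrArg Prod.snd e
    simp only at this
    linarith
  · refine ⟨_, _, ?_, rfl⟩
    intro e
    have := congrArg Prod.snd e
    simp only at this
    linarith

lemma yP_disj {R : ℤ} (hR : 0 < R) {b b' : Bool} (h : b ≠ b') :
    ¬ (yP R b ∩ yP R b').Infinite := by
  have hR' : (0 : ℝ) < R := by exact_mod_cast hR
  have key : yP R true ∩ yP R false = ∅ := by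
    ext p
    simp only [yP, if_true, mem_inter_iff, mem_seg_vert, mem_empty_iff_false, iff_false]
    rintro ⟨⟨h1, -⟩, h2⟩
    simp [mem_seg_vert] at h2
    linarith [h2.1]
  cases b <;> cases b' <;> simp_all [inter_comm]

lemma vert_infinite {c u w : ℝ} (h : u < w) : (segment ℝ (c, u) (c, w)).Infinite := by
  have hne : ((c, u) : ℝ × ℝ) ≠ (c, w) := by
    intro e
    have := congrArg Prod.snd e
    simp only at this
    linarith
  have := germ_left (c, u) (c, w)
  have := this.inter_infinite this (sub_ne_zero.2 hne.symm)
  rwa [inter_self] at this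

lemma aP_yP {R i : ℤ} (hi : 0 ≤ i) (hiR : i < R) (b : Bool) : (aP R i ∩ yP R b).Infinite := by
  have hi' : (0 : ℝ) ≤ i := by exact_mod_cast hi
  have hiR' : (i : ℝ) + 1 ≤ R := by exact_mod_cast hiR
  cases b
  · refine (vert_infinite (c := R) (u := ((2 * i * R - i ^ 2 : ℤ) : ℝ))
      (w := ((2 * i * R - i ^ 2 : ℤ) : ℝ) + 1 / 2) (by linarith)).mono ?_
    intro p hp
    refine ⟨Or.inr hp, ?_⟩
    rw [mem_seg_vert, uIcc_of_le (by linarith)] at hp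
    simp only [yP, Bool.false_eq_true, if_false]
    rw [mem_seg_vert, uIcc_of_le (by nlinarith)]
    obtain ⟨h1, h2, h3⟩ := hp
    push_cast at h2 h3
    exact ⟨h1, by nlinarith, by nlinarith⟩
  · refine (vert_infinite (c := -1) (u := ((-2 * i - i ^ 2 : ℤ) : ℝ))
      (w := ((-2 * i - i ^ 2 : ℤ) : ℝ) + 1 / 2) (by linarith)).mono ?_
    intro p hp
    refine ⟨Or.inl (Or.inl (by rwa [segment_symm])), ?_⟩
    rw [mem_seg_vert, uIcc_of_le (by linarith)] at hp
    simp only [yP, if_true]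
    rw [mem_seg_vert, uIcc_of_le (by nlinarith)]
    obtain ⟨h1, h2, h3⟩ := hp
    push_cast at h2 h3
    exact ⟨h1, by nlinarith, by nlinarith⟩

lemma piece_sub_aP {R i U W : ℤ} (h1 : -8 ≤ U) (h2 : -8 ≤ W) (h3 : U ≤ 8 * R) (h4 : W ≤ 8 * R) :
    piece i U W ⊆ aP R i := by
  intro p hp
  refine Or.inl (Or.inr ?_)
  rw [piece, mem_seg_pt] at hp
  rw [mem_seg_pt]
  refine ⟨?_, hp.2⟩
  have h1' : (-8 : ℝ) ≤ U := by exact_mod_cast h1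
  have h2' : (-8 : ℝ) ≤ W := by exact_mod_cast h2
  have h3' : (U : ℝ) ≤ 8 * R := by exact_mod_cast h3
  have h4' : (W : ℝ) ≤ 8 * R := by exact_mod_cast h4
  refine uIcc_subset_uIcc ?_ ?_ hp.1 <;> rw [mem_uIcc] <;> left <;> constructor <;> linarith

lemma bP_aP {R i k : ℤ} (hi : 0 ≤ i) (hiR : i < R) (hk : 0 ≤ k) (hkR : 2 * k + 1 < R) :
    (bP i k ∩ aP R (2 * k)).Infinite ∧ (bP i k ∩ aP R i).Infinite ∧
      (bP i k ∩ aP R (2 * k + 1)).Infinite := by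
  refine ⟨?_, ?_, ?_⟩
  · refine (piece_infinite (a := 2 * k) (U := 4 * (i + 2 * k) - sg i) (W := 4 * (i + 2 * k))
      (by unfold sg; omega)).mono (subset_inter ?_ ?_)
    · intro p hp; exact Or.inl (Or.inl hp)
    · apply piece_sub_aP <;> (try unfold sg) <;> omega
  · refine (piece_infinite (a := i) (U := 4 * (i + 2 * k)) (W := 4 * (i + 2 * k + 1))
      (by omega)).mono (subset_inter ?_ ?_)
    · intro p hp; exact Or.inl (Or.inr hp)
    · apply piece_sub_aP <;> omega
  · refine (piece_infinite (a := 2 * k + 1) (U := 4 * (i + 2 * k + 1))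
      (W := 4 * (i + 2 * k + 1) - sg i)
      (by unfold sg; omega)).mono (subset_inter ?_ ?_)
    · intro p hp; exact Or.inr hp
    · apply piece_sub_aP <;> (try unfold sg) <;> omega

/-- Index type of the connector paths. -/
abbrev Beta (h : ℕ) : Type := {t : Fin (2 * h) × Fin h // t.2.val ≠ t.1.val / 2}

/-- The vertex set. -/
abbrev Vert (h : ℕ) : Type := Bool ⊕ (Fin (2 * h) ⊕ Beta h)

/-- The representation. -/
def rep (h : ℕ) : Vert h → Set (ℝ × ℝ)
  | Sum.inl b => yP (2 * h) b
  | Sum.inr (Sum.inl i) => aP (2 * h) i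
  | Sum.inr (Sum.inr t) => bP t.1.1 t.1.2

lemma beta_card (h : ℕ) : 2 * h ^ 2 ≤ Fintype.card (Beta h) + 2 * h ∧
    Fintype.card (Beta h) ≤ 2 * h ^ 2 := by
  have h1 : Fintype.card (Fin (2 * h) × Fin h) = 2 * h ^ 2 := by
    simp; ring
  have h2 := Fintype.card_subtype_compl (fun t : Fin (2 * h) × Fin h => t.2.val = t.1.val / 2)
  have h3 := Fintype.card_subtype_le (fun t : Fin (2 * h) × Fin h => t.2.val = t.1.val / 2)
  have h4 : Fintype.card {t : Fin (2 * h) × Fin h // t.2.val = t.1.val / 2} ≤ 2 * h := by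
    have := Fintype.card_le_of_injective
      (fun t : {t : Fin (2 * h) × Fin h // t.2.val = t.1.val / 2} => t.1.1) (by
        rintro ⟨⟨a, b⟩, hab⟩ ⟨⟨a', b'⟩, hab'⟩ e
        simp only at e hab hab'
        subst e
        have : b = b' := Fin.ext (hab.trans hab'.symm)
        subst this
        rfl)
    simpa using this
  rw [h1] at h2 h3
  change Fintype.card (Beta h) = _ at h2
  omega

/-- The three `A`-neighbours of a connector. -/
def tri (h : ℕ) (t : Beta h) : Fin 3 → Fin (2 * h) :=
  ![⟨2 * t.1.2, by have := t.1.2.2; omega⟩, t.1.1, ⟨2 * t.1.2 + 1, by have := t.1.2.2; omega⟩]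

lemma tri_inj (h : ℕ) (t : Beta h) : Function.Injective (tri h t) := by
  obtain ⟨⟨i, k⟩, hik⟩ := t
  simp only at hik
  intro a b hab
  fin_cases a <;> fin_cases b <;> simp [tri, Fin.ext_iff] at hab ⊢ <;> omega

lemma rep_path {h : ℕ} (hh : 0 < h) (v : Vert h) : IsUn2BendPath (rep h v) := by
  rcases v with b | i | ⟨⟨i, k⟩, hik⟩
  · exact yP_path (by omega) b
  · exact aP_path (by omega) _
  · simp only at hik
    exact bP_path _ _ (by simp only; omega) (by simp only; omega)

end Slopes


/-- There is a constant `K > 0` such that for every positive integer `m` there is a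
graph on at most `K·m²` vertices which is an unaligned 2-bend EPG graph, but every
unaligned 2-bend EPG representation of it uses at least `m/2` pairwise non-parallel
directions. Hence representing unaligned 2-bend graphs on `n` vertices may require
`Ω(√n)` slopes. -/
theorem stmt14 :
    ∃ K : ℝ, 0 < K ∧ ∀ m : ℕ, 0 < m →
      ∃ (N : ℕ) (G : SimpleGraph (Fin N)),
        (N : ℝ) ≤ K * (m : ℝ) ^ 2 ∧
        (∃ f : Fin N → Set (ℝ × ℝ), IsUn2BendEPG G f) ∧
        ∀ f : Fin N → Set (ℝ × ℝ), IsUn2BendEPG G f →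
          ∀ D : Set (Submodule ℝ (ℝ × ℝ)), D.Finite →
            (∀ v, Un2BendWithDirs (f v) D) → m / 2 ≤ D.ncard := by
  refine ⟨1000000, by norm_num, fun m hm => ?_⟩
  obtain ⟨h, hdef⟩ : ∃ h, h = 500 * m := ⟨_, rfl⟩
  have hh : 0 < h := by omega
  let e : Slopes.Vert h ≃ Fin (Fintype.card (Slopes.Vert h)) := Fintype.equivFin _
  obtain ⟨hβ1, hβ2⟩ := Slopes.beta_card h
  let G : SimpleGraph (Fin (Fintype.card (Slopes.Vert h))) :=
    { Adj := fun u v => u ≠ v ∧ (Slopes.rep h (e.symm u) ∩ Slopes.rep h (e.symm v)).Infinite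
      symm := ⟨fun u v huv => ⟨huv.1.symm, by rw [inter_comm]; exact huv.2⟩⟩
      loopless := ⟨fun u hu => hu.1 rfl⟩ }
  refine ⟨_, G, ?_, ⟨fun v => Slopes.rep h (e.symm v), fun v => Slopes.rep_path hh _, ?_⟩, ?_⟩
  · have h1 : Fintype.card (Slopes.Vert h) ≤ 1000000 * m ^ 2 := by
      have : Fintype.card (Slopes.Vert h) = 2 + (2 * h + Fintype.card (Slopes.Beta h)) := by
        simp only [Slopes.Vert, Fintype.card_sum, Fintype.card_bool, Fintype.card_fin]
      rw [this]
      subst hdef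
      nlinarith
    exact_mod_cast h1
  · intro u v huv
    exact ⟨fun h => h.2, fun h => ⟨huv, h⟩⟩
  · intro f hf D hD hfD
    have pos : ∀ u v : Slopes.Vert h, u ≠ v → (Slopes.rep h u ∩ Slopes.rep h v).Infinite →
        (f (e u) ∩ f (e v)).Infinite := by
      intro u v huv hov
      rw [← hf.2 _ _ (fun hc => huv (e.injective hc))]
      exact ⟨fun hc => huv (e.injective hc), by simpa using hov⟩
    have neg : ∀ u v : Slopes.Vert h, u ≠ v → ¬ (Slopes.rep h u ∩ Slopes.rep h v).Infinite →
        ¬ (f (e u) ∩ f (e v)).Infinite := by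
      intro u v huv hov
      rw [← hf.2 _ _ (fun hc => huv (e.injective hc))]
      rintro ⟨_, hc⟩
      exact hov (by simpa using hc)
    obtain ⟨L, par, h1, h2, h3, h4⟩ := Slopes.lower hD
      (fun b => f (e (Sum.inl b))) (fun i => f (e (Sum.inr (Sum.inl i))))
      (fun t => f (e (Sum.inr (Sum.inr t)))) (fun _ => hfD _) (fun _ => hfD _) (fun _ => hfD _)
      (by
        intro i j hij
        exact neg _ _ (by simpa using hij) (Slopes.yP_disj (by omega) hij))
      (by
        intro i j hij
        refine neg _ _ (by simpa using hij) (Slopes.aP_disj ?_ ?_ ?_ ?_ ?_)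
        · omega
        · omega
        · have := i.2; omega
        · have := j.2; omega
        · intro hc; exact hij (Fin.ext (by omega)))
      (by
        intro s t hst
        refine neg _ _ (by simpa using hst) ?_
        intro hc
        obtain ⟨⟨i, k⟩, hik⟩ := s
        obtain ⟨⟨i', k'⟩, hik'⟩ := t
        simp only at hik hik'
        have := Slopes.bP_disj (by simp only; omega) (by simp only; omega) (by simp only; omega)
          (by simp only; omega) hc
        simp only at this
        apply hst
        have e1 : i = i' := Fin.ext (by omega)
        have e2 : k = k' := Fin.ext (by omega)
        subst e1 e2
        rfl)
      (by
        intro i y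
        exact pos _ _ (by simp) (Slopes.aP_yP (by omega) (by have := i.2; omega) y))
      (Slopes.tri h) (Slopes.tri_inj h)
      (by
        intro t k
        refine pos _ _ (by simp) ?_
        have hi := t.1.1.2
        have hk := t.1.2.2
        have key := Slopes.bP_aP (R := 2 * h) (i := t.1.1) (k := t.1.2) (by omega) (by omega)
          (by omega) (by omega)
        fin_cases k
        · simpa [Slopes.rep, Slopes.tri] using key.1
        · simpa [Slopes.rep, Slopes.tri] using key.2.1
        · simpa [Slopes.rep, Slopes.tri] using key.2.2)
    rw [Fintype.card_fin] at h1 h4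
    have hL : L ^ 2 ≤ (2 * h + 42) ^ 2 := Nat.pow_le_pow_left h1 2
    have hpar : par ≤ 1960 * h := by nlinarith
    have hlow : 4 * h ^ 2 ≤ L ^ 2 + 28 * h := by nlinarith
    have hmul : D.ncard * par ≤ D.ncard * (1960 * h) := Nat.mul_le_mul_left _ hpar
    have hfin : h * (4 * h) ≤ h * (1960 * D.ncard + 28) := by nlinarith
    have := Nat.le_of_mul_le_mul_left hfin hh
    omega
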